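/- Let n ≥ 3 and let 𝒦 ⊂ SL_n(ℝ) be a compact set. Then there exists a constant C = C(𝒦, n) such that for every 0 < ε ≤ 1 there exists a finite set ℐ_ε ⊂ 𝒦 with #ℐ_ε ≤ C·ε^{−d_n}, where d_n = (n+2)(n−1)/2, such that 𝒦 ⊆ ∪_{h ∈ ℐ_ε} O_ε·h (the union of left translates O_ε h = {g·h : g ∈ O_ε}). -/

import Mathlib

open MeasureTheory Matrix

noncomputable section

/-- `SL_n(ℝ)`. -/
abbrev SLR (n : ℕ) := Matrix.SpecialLinearGroup (Fin n) ℝ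

instance (n : ℕ) : TopologicalSpace (SLR n) :=
  TopologicalSpace.induced (fun g => (g : Matrix (Fin n) (Fin n) ℝ)) inferInstance

instance (n : ℕ) : MeasurableSpace (SLR n) := borel _

/-- Euclidean norm on `ℝⁿ`. -/
def eucNorm {n : ℕ} (v : Fin n → ℝ) : ℝ := Real.sqrt (∑ i, v i ^ 2)

/-- The operator norm `‖g‖_op = sup{‖vg‖ : ‖v‖ = 1}` (row vectors, right action). -/
def opNorm {n : ℕ} (g : SLR n) : ℝ :=
  sSup {r : ℝ | ∃ v : Fin n → ℝ, eucNorm v = 1 ∧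
    r = eucNorm (Matrix.vecMul v (g : Matrix (Fin n) (Fin n) ℝ))}

/-- The symmetric norm `‖g‖ = max{‖g‖_op, ‖g⁻¹‖_op}`. -/
def gNorm {n : ℕ} (g : SLR n) : ℝ := max (opNorm g) (opNorm g⁻¹)

/-- The norm ball `O_ε = {g ∈ SL_n(ℝ) : ‖g‖ < 1 + ε}`. -/
def Oball (n : ℕ) (ε : ℝ) : Set (SLR n) := {g | gNorm g < 1 + ε}

/-- `d_n = (n+2)(n−1)/2`. -/
def dn (n : ℕ) : ℕ := (n + 2) * (n - 1) / 2

/-- The positive definite form `g⁻¹ g⁻ᵀ` attached to `g`, as a polynomial in the entries of `g`. -/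
def invGram {n : ℕ} (A : Matrix (Fin n) (Fin n) ℝ) : Matrix (Fin n) (Fin n) ℝ :=
  A.adjugate * A.adjugateᵀ

theorem continuous_invGram {n : ℕ} :
    Continuous (invGram : Matrix (Fin n) (Fin n) ℝ → Matrix (Fin n) (Fin n) ℝ) := by
  have h : Continuous fun A : Matrix (Fin n) (Fin n) ℝ => A.adjugate :=
    continuous_id.matrix_adjugate
  exact h.matrix_mul h.matrix_transpose

theorem invGram_symm {n : ℕ} (A : Matrix (Fin n) (Fin n) ℝ) (i j : Fin n) :
    invGram A i j = invGram A j i := by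
  simp only [invGram, Matrix.mul_apply, Matrix.transpose_apply, mul_comm]

theorem det_invGram {n : ℕ} (g : SLR n) : (invGram (g : Matrix (Fin n) (Fin n) ℝ)).det = 1 := by
  simp [invGram, Matrix.det_adjugate]

theorem adjugate_invGram {n : ℕ} (g : SLR n) :
    (invGram (g : Matrix (Fin n) (Fin n) ℝ)).adjugate =
      (g : Matrix (Fin n) (Fin n) ℝ)ᵀ * (g : Matrix (Fin n) (Fin n) ℝ) := by
  have h1 : (g : Matrix (Fin n) (Fin n) ℝ).adjugate.adjugate = g := by
    rw [← Matrix.SpecialLinearGroup.coe_inv, ← Matrix.SpecialLinearGroup.coe_inv, inv_inv]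
  rw [invGram, Matrix.adjugate_mul_distrib, ← Matrix.adjugate_transpose, h1]

theorem adjugate_invGram_diag_pos {n : ℕ} (g : SLR n) (i : Fin n) :
    0 < (invGram (g : Matrix (Fin n) (Fin n) ℝ)).adjugate i i := by
  rw [adjugate_invGram, Matrix.mul_apply]
  simp only [Matrix.transpose_apply]
  refine lt_of_le_of_ne (Finset.sum_nonneg fun k _ => mul_self_nonneg _) fun h => ?_
  have h0 := (Finset.sum_eq_zero_iff_of_nonneg fun k _ => mul_self_nonneg _).1 h.symm
  have := Matrix.det_eq_zero_of_column_eq_zero (A := (g : Matrix (Fin n) (Fin n) ℝ)) i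
    fun k => by simpa using h0 k (Finset.mem_univ k)
  rw [g.det_coe] at this
  exact one_ne_zero this

/-- Adding `c` to a diagonal entry changes the determinant by `c` times the cofactor. -/
theorem det_add_single_diag {n : ℕ} (A : Matrix (Fin n) (Fin n) ℝ) (i : Fin n) (c : ℝ) :
    (A + Matrix.single i i c).det = A.det + c * A.adjugate i i := by
  have h : A + Matrix.single i i c = A.updateRow i (A i + c • Pi.single i 1) := by
    ext k l
    by_cases hk : k = i
    · subst hk
      simp [Matrix.single_apply, Pi.single_apply, eq_comm]
    · simp [Matrix.updateRow_ne hk, Ne.symm hk]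
  rw [h, Matrix.det_updateRow_add, Matrix.det_updateRow_smul, Matrix.updateRow_eq_self,
    Matrix.adjugate_apply]

theorem exists_abs_det_sub_le (n : ℕ) (R : ℝ) :
    ∃ L : ℝ, 0 ≤ L ∧ ∀ (A B : Matrix (Fin n) (Fin n) ℝ) (δ : ℝ), 0 ≤ δ →
      (∀ i j, |A i j| ≤ R) → (∀ i j, |B i j| ≤ R) → (∀ i j, |A i j - B i j| ≤ δ) →
      |A.det - B.det| ≤ L * δ := by
  let f : (Fin n → Fin n → ℝ) → ℝ := fun A => Matrix.det (Matrix.of A)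
  have hf : ContDiff ℝ 1 f := by
    simp only [f, Matrix.det_apply', Matrix.of_apply]
    fun_prop
  obtain ⟨L, hL⟩ := hf.locallyLipschitz.locallyLipschitzOn.exists_lipschitzOnWith_of_compact
    (isCompact_closedBall (0 : Fin n → Fin n → ℝ) R)
  refine ⟨L, L.2, fun A B δ hδ hA hB hAB => ?_⟩
  rcases isEmpty_or_nonempty (Fin n) with _ | ⟨⟨i₀⟩⟩
  · simpa [Matrix.det_isEmpty] using mul_nonneg L.2 hδ
  have hR : 0 ≤ R := (abs_nonneg _).trans (hA i₀ i₀)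
  have hmem : ∀ A : Matrix (Fin n) (Fin n) ℝ, (∀ i j, |A i j| ≤ R) →
      (fun i j => A i j) ∈ Metric.closedBall (0 : Fin n → Fin n → ℝ) R := by
    intro A hA
    rw [mem_closedBall_zero_iff, pi_norm_le_iff_of_nonneg hR]
    intro i
    rw [pi_norm_le_iff_of_nonneg hR]
    exact hA i
  have h := hL.dist_le_mul _ (hmem A hA) _ (hmem B hB)
  have hd : dist (fun i j => A i j) (fun i j => B i j) ≤ δ := by
    rw [dist_pi_le_iff hδ]
    intro i
    rw [dist_pi_le_iff hδ]
    exact hAB i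
  exact h.trans (mul_le_mul_of_nonneg_left hd L.2)

theorem dotProduct_vecMul_adjugate {n : ℕ} (A : Matrix (Fin n) (Fin n) ℝ) (w : Fin n → ℝ) :
    (w ᵥ* A.adjugate) ⬝ᵥ (w ᵥ* A.adjugate) = ∑ i, ∑ j, w i * w j * invGram A i j := by
  have : (w ᵥ* A.adjugate) ⬝ᵥ (w ᵥ* A.adjugate) = w ⬝ᵥ (invGram A *ᵥ w) := by
    rw [invGram, ← Matrix.mulVec_mulVec, Matrix.mulVec_transpose, Matrix.dotProduct_mulVec]
  rw [this]
  simp only [dotProduct, Matrix.mulVec, Finset.mul_sum]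
  exact Finset.sum_congr rfl fun i _ => Finset.sum_congr rfl fun j _ => by ring

theorem eucNorm_sq {n : ℕ} (v : Fin n → ℝ) : eucNorm v ^ 2 = v ⬝ᵥ v := by
  rw [eucNorm, Real.sq_sqrt (Finset.sum_nonneg fun i _ => sq_nonneg _)]
  simp only [dotProduct, sq]

theorem abs_le_eucNorm {n : ℕ} (v : Fin n → ℝ) (i : Fin n) : |v i| ≤ eucNorm v :=
  Real.abs_le_sqrt (Finset.single_le_sum (f := fun i => v i ^ 2)
    (fun _ _ => sq_nonneg _) (Finset.mem_univ i))

theorem opNorm_mul_inv_le {n : ℕ} (g h : SLR n) {R η ε : ℝ} (hε : 0 ≤ ε)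
    (hg : ∀ i j, |(g : Matrix (Fin n) (Fin n) ℝ) i j| ≤ R)
    (hgh : ∀ i j, |invGram (h : Matrix (Fin n) (Fin n) ℝ) i j -
      invGram (g : Matrix (Fin n) (Fin n) ℝ) i j| ≤ η)
    (hη : (n * (n * R)) ^ 2 * η ≤ ε) :
    opNorm (g * h⁻¹) ≤ 1 + ε / 2 := by
  refine Real.sSup_le ?_ (by linarith)
  rintro _ ⟨v, hv, rfl⟩
  set w := v ᵥ* (g : Matrix (Fin n) (Fin n) ℝ) with hw
  have hvh : v ᵥ* ((g * h⁻¹ : SLR n) : Matrix (Fin n) (Fin n) ℝ) =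
      w ᵥ* (h : Matrix (Fin n) (Fin n) ℝ).adjugate := by
    simp [hw, Matrix.vecMul_vecMul]
  have hvg : w ᵥ* (g : Matrix (Fin n) (Fin n) ℝ).adjugate = v := by
    simp [hw, Matrix.vecMul_vecMul, Matrix.mul_adjugate]
  have h1 : ∑ i, ∑ j, w i * w j * invGram (g : Matrix (Fin n) (Fin n) ℝ) i j = 1 := by
    rw [← dotProduct_vecMul_adjugate, hvg, ← eucNorm_sq, hv, one_pow]
  have hwb : ∀ j, |w j| ≤ n * R := by
    intro j
    have hwj : w j = ∑ i, v i * (g : Matrix (Fin n) (Fin n) ℝ) i j := rfl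
    rw [hwj]
    calc _ ≤ ∑ i, |v i * (g : Matrix (Fin n) (Fin n) ℝ) i j| :=
          Finset.abs_sum_le_sum_abs _ _
      _ ≤ ∑ _i : Fin n, R := Finset.sum_le_sum fun i _ => by
          rw [abs_mul]
          have := (abs_le_eucNorm v i).trans_eq hv
          exact (mul_le_of_le_one_left (abs_nonneg _) this).trans (hg i j)
      _ = n * R := by simp
  have hdiff : ∑ i, ∑ j, w i * w j * invGram (h : Matrix (Fin n) (Fin n) ℝ) i j -
      ∑ i, ∑ j, w i * w j * invGram (g : Matrix (Fin n) (Fin n) ℝ) i j ≤ ε := by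
    rw [← Finset.sum_sub_distrib]
    simp only [← Finset.sum_sub_distrib, ← mul_sub]
    calc _ ≤ ∑ _i : Fin n, ∑ _j : Fin n, (n * R) * (n * R) * η :=
          Finset.sum_le_sum fun i _ => Finset.sum_le_sum fun j _ => by
            refine (le_abs_self _).trans ?_
            rw [abs_mul, abs_mul]
            have := (abs_nonneg _).trans (hwb i)
            exact mul_le_mul (mul_le_mul (hwb i) (hwb j) (abs_nonneg _) this) (hgh i j)
              (abs_nonneg _) (mul_nonneg this this)
      _ = (n * (n * R)) ^ 2 * η := by simp; ring
      _ ≤ ε := hη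
  rw [hvh]
  refine abs_le_of_sq_le_sq' ?_ (by linarith) |>.2
  rw [eucNorm_sq, dotProduct_vecMul_adjugate]
  nlinarith [sq_nonneg ε]

/-- A bounded family of points of `ℝᴶ` is covered by boxes of side `δ` centred at
`(2⌈R/δ⌉ + 1)^#J` of its points. -/
theorem exists_finset_box_cover {α J : Type*} [Fintype J] (K : Set α) (f : α → J → ℝ)
    {R δ : ℝ} (hδ : 0 < δ) (hf : ∀ g ∈ K, ∀ p, |f g p| ≤ R) :
    ∃ I : Finset α, (I : Set α) ⊆ K ∧ I.card ≤ (2 * ⌈R / δ⌉₊ + 1) ^ Fintype.card J ∧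
      ∀ g ∈ K, ∃ h ∈ I, ∀ p, |f g p - f h p| ≤ δ := by
  classical
  set N := ⌈R / δ⌉₊
  let φ : α → J → ℤ := fun g p => ⌊f g p / δ⌋
  let F : Finset (J → ℤ) := Fintype.piFinset fun _ => Finset.Icc (-(N : ℤ)) N
  have hF : F.card = (2 * N + 1) ^ Fintype.card J := by
    rw [Fintype.card_piFinset, Finset.prod_const, Int.card_Icc, Finset.card_univ]
    congr 1
    lia
  have hφ : φ '' K ⊆ F := by
    rintro _ ⟨g, hg, rfl⟩
    simp only [F, Finset.mem_coe, Fintype.mem_piFinset, Finset.mem_Icc]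
    intro p
    have hb : |f g p / δ| ≤ N := by
      rw [abs_div, abs_of_pos hδ]
      exact (div_le_div_of_nonneg_right (hf g hg p) hδ.le).trans (Nat.le_ceil _)
    obtain ⟨hl, hu⟩ := abs_le.1 hb
    refine ⟨Int.le_floor.2 (by exact_mod_cast hl), ?_⟩
    exact_mod_cast (Int.floor_le _).trans hu
  obtain ⟨s, hsK, hs⟩ := Set.exists_subset_bijOn K φ
  have hfin : s.Finite := by
    refine Set.Finite.of_finite_image ?_ hs.injOn
    exact F.finite_toSet.subset ((Set.image_mono hsK).trans hφ)
  refine ⟨hfin.toFinset, by simpa using hsK, ?_, fun g hg => ?_⟩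
  · rw [← hF]
    refine Finset.card_le_card_of_injOn φ (fun x hx => ?_) (by simpa using hs.injOn)
    exact hφ ⟨x, hsK (by simpa using hx), rfl⟩
  · obtain ⟨h, hh, hhg⟩ := hs.surjOn ⟨g, hg, rfl⟩
    refine ⟨h, by simpa using hh, fun p => ?_⟩
    have := Int.abs_sub_lt_one_of_floor_eq_floor (congrFun hhg p).symm
    rw [← sub_div, abs_div, abs_of_pos hδ, div_lt_one hδ] at this
    exact this.le

/-- Upper triangular positions other than the corner `i₀`. -/
abbrev UpperIdx {n : ℕ} (i₀ : Fin n) : Type :=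
  {p : Fin n × Fin n // p.1 ≤ p.2 ∧ p ≠ (i₀, i₀)}

theorem card_upperIdx {n : ℕ} (i₀ : Fin n) : Fintype.card (UpperIdx i₀) = dn n := by
  have h1 : (Finset.univ.filter fun p : Fin n × Fin n => p.1 ≤ p.2).card = n * (n + 1) / 2 := by
    rw [Finset.card_filter, Fintype.sum_prod_type_right]
    simp only [Finset.sum_boole, Nat.cast_id]
    have : ∀ j : Fin n, (Finset.univ.filter fun i : Fin n => i ≤ j).card = (j : ℕ) + 1 := by
      intro j
      rw [← Fin.card_Iic]
      congr 1
      ext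
      simp
    simp only [this]
    rw [Fin.sum_univ_eq_sum_range fun k => k + 1]
    have := Finset.sum_range_id_mul_two (n + 1)
    rw [Finset.sum_range_succ'] at this
    simp only [add_zero, Nat.add_sub_cancel] at this
    rw [mul_comm n]
    lia
  have h2 : (Finset.univ.filter fun p : Fin n × Fin n => p.1 ≤ p.2 ∧ p ≠ (i₀, i₀)) =
      (Finset.univ.filter fun p : Fin n × Fin n => p.1 ≤ p.2).erase (i₀, i₀) := by
    ext p
    simp [and_comm]
  rw [Fintype.card_subtype, h2, Finset.card_erase_of_mem (by simp), h1, dn]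
  obtain ⟨m, rfl⟩ := Nat.exists_eq_succ_of_ne_zero i₀.pos.ne'
  have : (m + 1) * (m + 1 + 1) = (m + 1 + 2) * m + 2 := by ring
  simp only [Nat.succ_eq_add_one, Nat.add_sub_cancel, this]
  lia

theorem exists_abs_entry_le {α : Type*} [TopologicalSpace α] {n : ℕ} (K : Set α)
    (hK : IsCompact K) (F : α → Matrix (Fin n) (Fin n) ℝ) (hF : Continuous F) :
    ∃ R : ℝ, ∀ g ∈ K, ∀ i j, |F g i j| ≤ R := by
  obtain ⟨R, hR⟩ := hK.exists_bound_of_continuousOn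
    (f := fun g => (fun i j => F g i j : Fin n → Fin n → ℝ))
    (continuous_pi fun i => continuous_pi fun j => hF.matrix_elem i j).continuousOn
  exact ⟨R, fun g hg i j => (norm_le_pi_norm _ j).trans
    ((norm_le_pi_norm (fun i j => F g i j : Fin n → Fin n → ℝ) i).trans (hR g hg))⟩

/-- On a compact set, the upper triangular entries of `invGram` other than a fixed diagonal one
control all entries, since the determinant is `1`. -/
theorem exists_invGram_sub_le {n : ℕ} (i₀ : Fin n) (K : Set (SLR n)) (hK : IsCompact K) :
    ∃ D : ℝ, 0 ≤ D ∧ ∀ g ∈ K, ∀ h ∈ K, ∀ δ : ℝ, 0 ≤ δ →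
      (∀ p : UpperIdx i₀, |invGram (g : Matrix (Fin n) (Fin n) ℝ) p.1.1 p.1.2 -
        invGram (h : Matrix (Fin n) (Fin n) ℝ) p.1.1 p.1.2| ≤ δ) →
      ∀ i j, |invGram (g : Matrix (Fin n) (Fin n) ℝ) i j -
        invGram (h : Matrix (Fin n) (Fin n) ℝ) i j| ≤ D * δ := by
  have hcoe : Continuous fun g : SLR n => (g : Matrix (Fin n) (Fin n) ℝ) :=
    continuous_induced_dom
  have hS : Continuous fun g : SLR n => invGram (g : Matrix (Fin n) (Fin n) ℝ) :=
    continuous_invGram.comp hcoe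
  obtain ⟨R, hR⟩ := exists_abs_entry_le K hK _ hS
  obtain ⟨L, hL0, hL⟩ := exists_abs_det_sub_le n R
  obtain ⟨B, hB⟩ := hK.exists_bound_of_continuousOn
    (f := fun g : SLR n => ((invGram (g : Matrix (Fin n) (Fin n) ℝ)).adjugate i₀ i₀)⁻¹)
    ((hS.matrix_adjugate.matrix_elem i₀ i₀).inv₀
      fun g => (adjugate_invGram_diag_pos g i₀).ne').continuousOn
  refine ⟨max 1 (B * L), zero_le_one.trans (le_max_left _ _), fun g hg h hh δ hδ hgh => ?_⟩
  set S := invGram (g : Matrix (Fin n) (Fin n) ℝ) with hSg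
  set T := invGram (h : Matrix (Fin n) (Fin n) ℝ) with hTh
  have hoff : ∀ i j, (i, j) ≠ (i₀, i₀) → |S i j - T i j| ≤ δ := by
    intro i j hij
    rcases le_total i j with hle | hle
    · exact hgh ⟨(i, j), hle, hij⟩
    · rw [hSg, hTh, invGram_symm _ i j, invGram_symm _ i j]
      exact hgh ⟨(j, i), hle, fun h => hij (by simp_all)⟩
  have hcorner : |S i₀ i₀ - T i₀ i₀| ≤ B * L * δ := by
    set c := S i₀ i₀ - T i₀ i₀ with hc
    set U := T + Matrix.single i₀ i₀ c with hU
    have hU0 : U i₀ i₀ = S i₀ i₀ := by simp [hU, hc]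
    have hU1 : ∀ i j, (i, j) ≠ (i₀, i₀) → U i j = T i j := by
      intro i j hij
      have : ¬(i₀ = i ∧ i₀ = j) := fun h => hij (by simp [← h.1, ← h.2])
      simp [hU, this]
    have hdet := hL U S δ hδ ?_ (hR g hg) ?_
    · rw [hU, det_add_single_diag, hSg, hTh, det_invGram, det_invGram, add_sub_cancel_left,
        ← hTh] at hdet
      have hpos : 0 < T.adjugate i₀ i₀ := adjugate_invGram_diag_pos h i₀
      have hBh := (le_abs_self _).trans (hB h hh)
      rw [abs_mul, abs_of_pos hpos, ← le_div_iff₀ hpos, div_eq_mul_inv] at hdet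
      calc |c| ≤ L * δ * (T.adjugate i₀ i₀)⁻¹ := hdet
        _ ≤ L * δ * B := mul_le_mul_of_nonneg_left hBh (mul_nonneg hL0 hδ)
        _ = B * L * δ := by ring
    · intro i j
      by_cases hij : (i, j) = (i₀, i₀)
      · obtain ⟨rfl, rfl⟩ := Prod.mk.inj hij
        rw [hU0]
        exact hR g hg _ _
      · rw [hU1 i j hij]
        exact hR h hh i j
    · intro i j
      by_cases hij : (i, j) = (i₀, i₀)
      · obtain ⟨rfl, rfl⟩ := Prod.mk.inj hij
        simpa [hU0] using hδ
      · rw [hU1 i j hij, abs_sub_comm]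
        exact hoff i j hij
  intro i j
  by_cases hij : (i, j) = (i₀, i₀)
  · obtain ⟨rfl, rfl⟩ := Prod.mk.inj hij
    exact hcorner.trans (mul_le_mul_of_nonneg_right (le_max_right _ _) hδ)
  · exact (hoff i j hij).trans (le_mul_of_one_le_left hδ (le_max_left _ _))

/-- The covering lemma: a compact set `𝒦 ⊂ SL_n(ℝ)` can be covered by
`O_𝒦(ε^{−d_n})` right translates `O_ε·h` with `h ∈ 𝒦`. -/
theorem covering_lemma
    (n : ℕ) (hn : 3 ≤ n) (K : Set (SLR n)) (hK : IsCompact K) :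
    ∃ C > (0 : ℝ), ∀ ε : ℝ, 0 < ε → ε ≤ 1 →
      ∃ Iε : Finset (SLR n), (Iε : Set (SLR n)) ⊆ K ∧
        (Iε.card : ℝ) ≤ C / ε ^ dn n ∧
        K ⊆ ⋃ h ∈ Iε, (fun g => g * h) '' Oball n ε := by
  have hcoe : Continuous fun g : SLR n => (g : Matrix (Fin n) (Fin n) ℝ) :=
    continuous_induced_dom
  obtain ⟨R₁, hR₁⟩ := exists_abs_entry_le K hK _ hcoe
  obtain ⟨R₂, hR₂⟩ := exists_abs_entry_le K hK _ (continuous_invGram.comp hcoe)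
  let i₀ : Fin n := ⟨0, by lia⟩
  obtain ⟨D, hD0, hD⟩ := exists_invGram_sub_le i₀ K hK
  set A := (n * (n * R₁)) ^ 2 * D + 1 with hA
  have hA0 : 0 < A := by positivity
  refine ⟨(2 * (|R₂| * A) + 3) ^ dn n, by positivity, fun ε hε hε1 => ?_⟩
  have hδ : 0 < ε / A := by positivity
  obtain ⟨I, hIK, hcard, hcov⟩ := exists_finset_box_cover K
    (fun g (p : UpperIdx i₀) => invGram (g : Matrix (Fin n) (Fin n) ℝ) p.1.1 p.1.2)
    hδ (R := |R₂|) (fun g hg p => (hR₂ g hg _ _).trans (le_abs_self _))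
  refine ⟨I, hIK, ?_, fun g hg => ?_⟩
  · rw [card_upperIdx] at hcard
    have h1 : (I.card : ℝ) ≤ (2 * ⌈|R₂| / (ε / A)⌉₊ + 1) ^ dn n := by exact_mod_cast hcard
    rw [← div_pow]
    refine h1.trans (pow_le_pow_left₀ (by positivity) ?_ _)
    have h2 := (Nat.ceil_lt_add_one (a := |R₂| / (ε / A)) (by positivity)).le
    have h3 : |R₂| / (ε / A) = |R₂| * A / ε := by field_simp
    have h4 : 3 ≤ 3 / ε := by rw [le_div_iff₀ hε]; linarith
    rw [add_div, mul_div_assoc, ← h3]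
    linarith
  · obtain ⟨h, hh, hgh⟩ := hcov g hg
    have hclose := hD g hg h (hIK hh) _ hδ.le hgh
    have hη : (n * (n * R₁)) ^ 2 * (D * (ε / A)) ≤ ε := by
      rw [← mul_assoc, mul_div_assoc', div_le_iff₀ hA0, hA]
      linarith
    refine Set.mem_iUnion₂.2 ⟨h, hh, g * h⁻¹, ?_, by simp⟩
    have h1 := opNorm_mul_inv_le g h hε.le (hR₁ g hg)
      (fun i j => (abs_sub_comm _ _).trans_le (hclose i j)) hη
    have h2 := opNorm_mul_inv_le h g hε.le (hR₁ h (hIK hh)) hclose hη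
    have h3 : (g * h⁻¹)⁻¹ = h * g⁻¹ := by simp
    rw [Oball, Set.mem_ofPred_eq, gNorm, h3]
    exact (max_le h1 h2).trans_lt (by linarith)

end
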